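/- Let B ∈ ℝ^{n×m}, C ∈ ℝ^{m×n}, D ∈ ℝ^m, and let f : [0,T] × ℝⁿ → ℝⁿ satisfy Assumptions (ii) and (iii). If there exists a symmetric positive definite matrix P ∈ ℝ^{n×n} such that P·B_{•i} = (C_{i•})ᵀ for all 1 ≤ i ≤ m (where B_{•i} is the i-th column of B and C_{i•} the i-th row of C), then for every x₀ ∈ ℝⁿ the differential inclusion ẋ(t) ∈ f(t, x(t)) - B·Sgn(Cx(t) + D) a.e. on (0,T) with x(0) = x₀ has a unique Lipschitz solution x : [0,T] → ℝⁿ. -/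

import Mathlib

open MeasureTheory Set

noncomputable section

/-- The set-valued sign function: `sgn(x) = {1}` if `x > 0`, `{-1}` if `x < 0`,
and `[-1,1]` if `x = 0`. -/
def sgnSet (x : ℝ) : Set ℝ := if 0 < x then {1} else if x < 0 then {-1} else Icc (-1) 1

/-- The componentwise set-valued sign function `Sgn : ℝᵐ ⇉ ℝᵐ`. -/
def SgnSet {m : ℕ} (y : EuclideanSpace ℝ (Fin m)) : Set (EuclideanSpace ℝ (Fin m)) :=
  {s | ∀ i, s i ∈ sgnSet (y i)}

/-- Matrix-vector product, as a map between Euclidean spaces. -/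
def mv {m n : ℕ} (M : Matrix (Fin m) (Fin n) ℝ) (x : EuclideanSpace ℝ (Fin n)) :
    EuclideanSpace ℝ (Fin m) := WithLp.toLp 2 fun i => ∑ j, M i j * x j

/-- A Lipschitz solution on `[0,T]` of the differential inclusion `ẋ(t) ∈ F(t, x(t))`,
`x(0) = x₀`. -/
def IsLipschitzSolution {E : Type*} [NormedAddCommGroup E] [NormedSpace ℝ E]
    (F : ℝ → E → Set E) (T : ℝ) (x₀ : E) (x : ℝ → E) : Prop :=
  (∃ K : NNReal, LipschitzOnWith K x (Icc 0 T)) ∧ x 0 = x₀ ∧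
    ∀ᵐ t ∂volume, t ∈ Ioo 0 T → ∃ v ∈ F t (x t), HasDerivAt x v t

/-- Assumption (ii): `f` is Lipschitz in its second argument, uniformly in `t ∈ [0,T]`. -/
def AssumptionII {E : Type*} [NormedAddCommGroup E] (T : ℝ) (f : ℝ → E → E) : Prop :=
  ∃ L : ℝ, 0 ≤ L ∧ ∀ t ∈ Icc (0 : ℝ) T, ∀ x₁ x₂ : E, ‖f t x₁ - f t x₂‖ ≤ L * ‖x₁ - x₂‖

/-- Assumption (iii): `f(·,x)` is differentiable in `t` and `Φ(R) < ∞` for every `R ≥ 0`. -/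
def AssumptionIII {E : Type*} [NormedAddCommGroup E] [NormedSpace ℝ E]
    (T : ℝ) (f : ℝ → E → E) : Prop :=
  (∀ x : E, Differentiable ℝ fun t => f t x) ∧
  ∀ R : ℝ, 0 ≤ R → ∃ M : ℝ,
    ∀ v : ℝ → E, eLpNorm v 2 (volume.restrict (Ioo 0 T)) ≤ ENNReal.ofReal R →
      eLpNorm (fun t => deriv (fun τ => f τ (v t)) t) 2 (volume.restrict (Ioo 0 T)) ≤
        ENNReal.ofReal M


open Filter Topology

/-- Gronwall inequality for Lipschitz functions with an a.e. derivative bound. -/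
lemma gronwall_ae {V : ℝ → ℝ} {T k e : ℝ} {K : NNReal} (hk : 0 ≤ k) (he : 0 ≤ e)
    (hV : LipschitzOnWith K V (Icc 0 T)) (h0 : V 0 = 0)
    (hd : ∀ᵐ t ∂volume, t ∈ Ioo 0 T → ∃ d, HasDerivAt V d t ∧ d ≤ k * V t + e) :
    ∀ t ∈ Icc (0 : ℝ) T, V t ≤ e * T * Real.exp (k * T) := by
  intro t ht
  have hsub : uIcc 0 t ⊆ Icc 0 T := by
    rw [uIcc_of_le ht.1]; exact Icc_subset_Icc le_rfl ht.2
  have hVac : AbsolutelyContinuousOnInterval V 0 t :=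
    (hV.mono hsub).absolutelyContinuousOnInterval
  have hexp : LipschitzOnWith (Real.toNNReal k) (fun τ => Real.exp (-k * τ)) (uIcc 0 t) := by
    refine (convex_uIcc 0 t).lipschitzOnWith_of_nnnorm_hasDerivWithin_le
      (f' := fun τ => Real.exp (-k * τ) * (-k * 1)) (fun τ _ => ?_) (fun τ hτ => ?_)
    · exact (((hasDerivAt_id τ).const_mul (-k)).exp).hasDerivWithinAt
    · rw [← NNReal.coe_le_coe, coe_nnnorm, Real.coe_toNNReal _ hk, norm_mul, Real.norm_eq_abs,
        Real.abs_exp, mul_one, norm_neg, Real.norm_eq_abs, abs_of_nonneg hk]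
      have : 0 ≤ τ := (hsub hτ).1
      have : Real.exp (-k * τ) ≤ 1 := Real.exp_le_one_iff.2 (by nlinarith)
      nlinarith
  have hg := hexp.absolutelyContinuousOnInterval.mul hVac
  have hi := hg.integral_deriv_eq_sub
  have hle : ∫ x in (0:ℝ)..t, deriv ((fun τ => Real.exp (-k * τ)) * V) x ≤ ∫ x in (0:ℝ)..t, e := by
    refine intervalIntegral.integral_mono_ae_restrict ht.1 hg.intervalIntegrable_deriv (by simp) ?_
    have h1 : ∀ᵐ x ∂(volume.restrict (Icc 0 t)), x ∈ Icc 0 t := ae_restrict_mem measurableSet_Icc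
    have h2 : ∀ᵐ x ∂(volume : Measure ℝ), x ≠ 0 := by
      simp [ae_iff, measure_singleton]
    have h3 : ∀ᵐ x ∂(volume : Measure ℝ), x ≠ t := by
      simp [ae_iff, measure_singleton]
    filter_upwards [h1, ae_restrict_of_ae h2, ae_restrict_of_ae h3, ae_restrict_of_ae hd]
      with x hx hx0 hxt hxd
    have hx1 : 0 < x := lt_of_le_of_ne hx.1 (Ne.symm hx0)
    have hx2 : x < t := lt_of_le_of_ne hx.2 hxt
    obtain ⟨d, hdd, hdle⟩ := hxd ⟨hx1, hx2.trans_le ht.2⟩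
    have := ((((hasDerivAt_id x).const_mul (-k)).exp).mul hdd).deriv
    have h4 : deriv ((fun τ => Real.exp (-k * τ)) * V) x =
      Real.exp (-k * x) * (-k * 1) * V x + Real.exp (-k * x) * d := this
    rw [h4]
    have : Real.exp (-k * x) ≤ 1 := Real.exp_le_one_iff.2 (by nlinarith)
    have hp := Real.exp_pos (-k * x)
    nlinarith [mul_le_mul_of_nonneg_left hdle hp.le]
  rw [hi] at hle
  simp only [Pi.mul_apply, h0, mul_zero, sub_zero, intervalIntegral.integral_const,
    smul_eq_mul] at hle
  have h5 : V t = Real.exp (k * t) * (Real.exp (-k * t) * V t) := by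
    rw [← mul_assoc, ← Real.exp_add]; simp
  rw [h5]
  have h6 : Real.exp (k * t) ≤ Real.exp (k * T) := by
    apply Real.exp_le_exp.2; nlinarith [ht.2]
  have h7 : t * e ≤ e * T := by nlinarith [ht.2]
  calc _ ≤ Real.exp (k * t) * (e * T) := mul_le_mul_of_nonneg_left (hle.trans h7) (Real.exp_pos _).le
    _ ≤ Real.exp (k * T) * (e * T) := by
        gcongr; exact mul_nonneg he (ht.1.trans ht.2)
    _ = _ := by ring

/-- Matrix-vector product as a continuous linear map. -/
def mvL {m n : ℕ} (M : Matrix (Fin m) (Fin n) ℝ) :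
    EuclideanSpace ℝ (Fin n) →L[ℝ] EuclideanSpace ℝ (Fin m) :=
  LinearMap.toContinuousLinearMap
    { toFun := mv M
      map_add' := fun x y => by
        ext i; simp [mv, mul_add, Finset.sum_add_distrib]
      map_smul' := fun c x => by
        ext i; simp only [mv, PiLp.smul_apply, smul_eq_mul, RingHom.id_apply, Finset.mul_sum]
        exact Finset.sum_congr rfl fun j _ => by ring }

lemma mvL_apply {m n : ℕ} (M : Matrix (Fin m) (Fin n) ℝ) (x) : mvL M x = mv M x := rfl

lemma sgn_mono {a b s r : ℝ} (hs : s ∈ sgnSet a) (hr : r ∈ sgnSet b) :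
    0 ≤ (a - b) * (s - r) := by
  unfold sgnSet at hs hr
  split_ifs at hs hr <;> simp only [mem_singleton_iff, mem_Icc] at hs hr <;>
    first
    | (subst hs; subst hr; nlinarith)
    | (obtain ⟨h1, h2⟩ := hr; subst hs; nlinarith)
    | (obtain ⟨h1, h2⟩ := hs; subst hr; nlinarith)
    | (have : a = b := by linarith
       subst this; simp)

lemma sgn_bd {a s : ℝ} (hs : s ∈ sgnSet a) : -1 ≤ s ∧ s ≤ 1 := by
  unfold sgnSet at hs
  split_ifs at hs <;> simp only [mem_singleton_iff, mem_Icc] at hs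
  · subst hs; norm_num
  · subst hs; norm_num
  · exact hs

lemma sgn_approx {y z s r ε δ : ℝ} (hε : 0 ≤ ε) (hδ : 0 ≤ δ) (hs : s ∈ sgnSet (y - ε * s))
    (hr : r ∈ sgnSet (z - δ * r)) : -(2 * (ε + δ)) ≤ (y - z) * (s - r) := by
  have h := sgn_mono hs hr
  obtain ⟨h1, h2⟩ := sgn_bd hs
  obtain ⟨h3, h4⟩ := sgn_bd hr
  have h5 : -2 ≤ s * (s - r) := by nlinarith
  have h6 : -2 ≤ -r * (s - r) := by nlinarith
  nlinarith [mul_le_mul_of_nonneg_left h5 hε, mul_le_mul_of_nonneg_left h6 hδ]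

/-- Saturation. -/
def sat (y : ℝ) : ℝ := max (-1) (min 1 y)

lemma sat_mem {ε y : ℝ} (hε : 0 < ε) : sat (y / ε) ∈ sgnSet (y - ε * sat (y / ε)) := by
  have hy : y = ε * (y / ε) := by field_simp
  set q := y / ε with hq
  rw [hy]
  unfold sat
  rcases le_total q (-1) with h | h
  · rw [min_eq_right (by linarith), max_eq_left h]
    unfold sgnSet
    rcases eq_or_lt_of_le h with h' | h'
    · rw [h']; simp
    · have : ε * q - ε * -1 < 0 := by nlinarith
      rw [if_neg this.not_gt, if_pos this]; simp
  · rcases le_total q 1 with h1 | h1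
    · rw [min_eq_right h1, max_eq_right h]
      simp [sgnSet, h, h1]
    · rw [min_eq_left h1, max_eq_right (by norm_num)]
      unfold sgnSet
      rcases eq_or_lt_of_le h1 with h' | h'
      · rw [← h']; simp
      · have : 0 < ε * q - ε * 1 := by nlinarith
        rw [if_pos this]; simp

lemma sat_lip (a b : ℝ) : |sat a - sat b| ≤ |a - b| := by
  unfold sat
  have h1 := abs_max_sub_max_le_max (-1) (min 1 a) (-1) (min 1 b)
  have h2 := abs_min_sub_min_le_max 1 a 1 b
  simp only [sub_self, abs_zero] at h1 h2
  exact h1.trans (max_le (abs_nonneg _) (h2.trans (max_le (abs_nonneg _) le_rfl)))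

lemma coercive {n : ℕ} (P : Matrix (Fin n) (Fin n) ℝ) (hP : P.PosDef) :
    ∃ c > 0, ∀ x : EuclideanSpace ℝ (Fin n), c * ‖x‖ ^ 2 ≤ inner ℝ (mvL P x) x := by
  have hpos : ∀ x : EuclideanSpace ℝ (Fin n), x ≠ 0 → 0 < inner ℝ (mvL P x) x := by
    intro x hx
    have := hP.dotProduct_mulVec_pos (x := x.ofLp) (by simpa using hx)
    rw [PiLp.inner_apply]
    simpa [mvL_apply, mv, dotProduct, Matrix.mulVec] using this
  by_cases hne : (Metric.sphere (0 : EuclideanSpace ℝ (Fin n)) 1).Nonempty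
  · obtain ⟨z, hz, hmin⟩ := (isCompact_sphere (0 : EuclideanSpace ℝ (Fin n)) 1).exists_isMinOn hne
      (f := fun x => inner ℝ (mvL P x) x) (by fun_prop)
    refine ⟨inner ℝ (mvL P z) z, hpos z ?_, fun x => ?_⟩
    · rintro rfl; simp at hz
    · by_cases hx : x = 0
      · simp [hx]
      · have hx' : 0 < ‖x‖ := norm_pos_iff.2 hx
        have := hmin (a := ‖x‖⁻¹ • x) (by simp [norm_smul, hx'.ne'])
        simp only [mem_ofPred_eq, map_smul, inner_smul_left, inner_smul_right] at this
        simp only [conj_trivial] at this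
        have h2 : ‖x‖⁻¹ * (‖x‖⁻¹ * inner ℝ (mvL P x) x) * ‖x‖ ^ 2 = inner ℝ (mvL P x) x := by
          field_simp
        nlinarith [mul_le_mul_of_nonneg_right this (sq_nonneg ‖x‖)]
  · refine ⟨1, one_pos, fun x => ?_⟩
    have : x = 0 := by
      by_contra hx
      exact hne ⟨‖x‖⁻¹ • x, by simp [norm_smul, norm_ne_zero_iff.2 hx]⟩
    simp [this]

lemma mv_adj {n m : ℕ} (B : Matrix (Fin n) (Fin m) ℝ) (C : Matrix (Fin m) (Fin n) ℝ)
    (P : Matrix (Fin n) (Fin n) ℝ) (hPsymm : P.IsSymm)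
    (hPB : ∀ i : Fin m, P.mulVec (fun j => B j i) = fun j => C i j) (w s) :
    inner ℝ (mvL P w) (mvL B s) = ∑ i, (mvL C w) i * s i := by
  have hC : ∀ i j, C i j = ∑ k, P j k * B k i := fun i j => (congrFun (hPB i) j).symm
  simp only [PiLp.inner_apply, mvL_apply, mv, hC]
  simp only [RCLike.inner_apply, conj_trivial, Finset.sum_mul, Finset.mul_sum]
  rw [Finset.sum_congr rfl fun i _ => Finset.sum_comm, Finset.sum_comm]
  refine Finset.sum_congr rfl fun i _ => ?_
  rw [Finset.sum_comm]
  refine Finset.sum_congr rfl fun j _ => Finset.sum_congr rfl fun k _ => ?_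
  rw [hPsymm.apply]
  ring

lemma mv_symm {n : ℕ} (P : Matrix (Fin n) (Fin n) ℝ) (hPsymm : P.IsSymm) (x y) :
    inner ℝ (mvL P x) y = inner ℝ x (mvL P y) := by
  simp only [PiLp.inner_apply, mvL_apply, mv]
  simp only [RCLike.inner_apply, conj_trivial, Finset.sum_mul, Finset.mul_sum]
  rw [Finset.sum_comm]
  refine Finset.sum_congr rfl fun j _ => Finset.sum_congr rfl fun k _ => ?_
  rw [hPsymm.apply]
  ring

/-- If the derivative lies in a closed convex set, so does the slope. -/
lemma slope_mem {E : Type*} [NormedAddCommGroup E] [NormedSpace ℝ E] {G : Set E}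
    (hGc : IsClosed G) (hG : Convex ℝ G) {g : ℝ → E} {a b : ℝ} (hab : a < b)
    (hg : ContinuousOn g (Icc a b)) (hd : ∀ t ∈ Ioo a b, ∃ v ∈ G, HasDerivAt g v t) :
    (b - a)⁻¹ • (g b - g a) ∈ G := by
  by_contra hcon
  obtain ⟨l, u, h1, h2⟩ := geometric_hahn_banach_point_closed hG hGc hcon
  choose! g' hg' hgd using hd
  obtain ⟨c, hc, hcc⟩ := exists_hasDerivAt_eq_slope (fun t => l (g t)) (fun t => l (g' t)) hab
    (l.continuous.comp_continuousOn hg) (fun t ht => l.hasFDerivAt.comp_hasDerivAt t (hgd t ht))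
  have h3 := h2 _ (hg' c hc)
  rw [map_smul, map_sub, smul_eq_mul, inv_mul_eq_div] at h1
  linarith

/-- Solutions of the inclusion regularised with parameter `ε`. -/
def IsApx {n m : ℕ} (f : ℝ → EuclideanSpace ℝ (Fin n) → EuclideanSpace ℝ (Fin n))
    (B : Matrix (Fin n) (Fin m) ℝ) (C : Matrix (Fin m) (Fin n) ℝ)
    (D : EuclideanSpace ℝ (Fin m)) (T : ℝ) (x₀ : EuclideanSpace ℝ (Fin n)) (ε : ℝ)
    (x : ℝ → EuclideanSpace ℝ (Fin n)) : Prop :=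
  (∃ K : NNReal, LipschitzOnWith K x (Icc 0 T)) ∧ x 0 = x₀ ∧
    ∀ᵐ t ∂volume, t ∈ Ioo 0 T → ∃ s : EuclideanSpace ℝ (Fin m),
      (∀ i, s i ∈ sgnSet ((mv C (x t) + D) i - ε * s i)) ∧
      HasDerivAt x (f t (x t) - mv B s) t

lemma quad_lip {E : Type*} [NormedAddCommGroup E] [InnerProductSpace ℝ E]
    (A : E →L[ℝ] E) {w : ℝ → E} {K : NNReal} {T : ℝ} (hT : 0 < T)
    (hw : LipschitzOnWith K w (Icc 0 T)) (h0 : w 0 = 0) :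
    ∃ K' : NNReal, LipschitzOnWith K' (fun t => inner ℝ (A (w t)) (w t)) (Icc 0 T) := by
  have hb : ∀ t ∈ Icc 0 T, ‖w t‖ ≤ K * T := by
    intro t ht
    have := hw.dist_le_mul t ht 0 ⟨le_rfl, hT.le⟩
    rw [h0, dist_zero_right, Real.dist_eq, sub_zero, abs_of_nonneg ht.1] at this
    exact this.trans (mul_le_mul_of_nonneg_left ht.2 K.2)
  refine ⟨Real.toNNReal (2 * (‖A‖ * (K * T)) * K), LipschitzOnWith.of_dist_le_mul ?_⟩
  intro s hs t ht
  rw [Real.coe_toNNReal _ (by positivity), Real.dist_eq]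
  have h1 : inner ℝ (A (w s)) (w s) - inner ℝ (A (w t)) (w t) =
      inner ℝ (A (w s - w t)) (w s) + inner ℝ (A (w t)) (w s - w t) := by
    rw [map_sub, inner_sub_left, inner_sub_right]; ring
  have h2 : ‖w s - w t‖ ≤ K * dist s t := by
    rw [← dist_eq_norm]; exact hw.dist_le_mul s hs t ht
  rw [h1]
  have h3 : |inner ℝ (A (w s - w t)) (w s)| ≤ ‖A‖ * (K * dist s t) * (K * T) := by
    refine (abs_real_inner_le_norm _ _).trans ?_
    gcongr
    · exact (A.le_opNorm _).trans (by gcongr)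
    · exact hb s hs
  have h4 : |inner ℝ (A (w t)) (w s - w t)| ≤ ‖A‖ * (K * T) * (K * dist s t) := by
    refine (abs_real_inner_le_norm _ _).trans ?_
    gcongr
    exact (A.le_opNorm _).trans (by gcongr; exact hb t ht)
  calc _ ≤ _ := abs_add_le _ _
    _ ≤ _ := add_le_add h3 h4
    _ = _ := by ring

lemma apx_estimate {n m : ℕ} {T : ℝ} (hT : 0 < T)
    {B : Matrix (Fin n) (Fin m) ℝ} {C : Matrix (Fin m) (Fin n) ℝ}
    {D : EuclideanSpace ℝ (Fin m)}
    {f : ℝ → EuclideanSpace ℝ (Fin n) → EuclideanSpace ℝ (Fin n)}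
    (hfII : AssumptionII T f)
    {P : Matrix (Fin n) (Fin n) ℝ} (hPsymm : P.IsSymm) (hPpos : P.PosDef)
    (hPB : ∀ i : Fin m, P.mulVec (fun j => B j i) = fun j => C i j)
    (x₀ : EuclideanSpace ℝ (Fin n)) :
    ∃ Q : ℝ, 0 ≤ Q ∧ ∀ ε δ x y, 0 ≤ ε → 0 ≤ δ → IsApx f B C D T x₀ ε x → IsApx f B C D T x₀ δ y →
      ∀ t ∈ Icc 0 T, ‖x t - y t‖ ^ 2 ≤ Q * (ε + δ) := by
  obtain ⟨L, hL, hfL⟩ := hfII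
  obtain ⟨c, hc, hco⟩ := coercive P hPpos
  set A := mvL P with hA
  set k := 2 * (‖A‖ * L) / c with hk
  have hk0 : 0 ≤ k := by positivity
  refine ⟨4 * m * T * Real.exp (k * T) / c, by positivity, ?_⟩
  rintro ε δ x y hε hδ ⟨⟨Kx, hKx⟩, hx0, hx⟩ ⟨⟨Ky, hKy⟩, hy0, hy⟩ t ht
  have hw : LipschitzOnWith (Kx + Ky) (fun t => x t - y t) (Icc 0 T) := hKx.sub hKy
  obtain ⟨K', hK'⟩ := quad_lip A hT hw (by simp [hx0, hy0])
  have key := gronwall_ae (k := k) (e := 4 * m * (ε + δ)) hk0 (by positivity) hK'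
    (by simp [hx0, hy0]) ?_ t ht
  · have h1 := (hco (x t - y t)).trans key
    rw [div_mul_eq_mul_div, le_div_iff₀ hc]
    linarith
  filter_upwards [hx, hy] with τ hxτ hyτ hτ
  obtain ⟨s, hs, hxd⟩ := hxτ hτ
  obtain ⟨r, hr, hyd⟩ := hyτ hτ
  have hwd := hxd.sub hyd
  have hAd := A.hasFDerivAt.comp_hasDerivAt τ hwd
  refine ⟨_, hAd.inner ℝ hwd, ?_⟩
  set w := x τ - y τ with hwdef
  set u := f τ (x τ) - mv B s - (f τ (y τ) - mv B r) with hu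
  have hsum : inner ℝ (A w) u + inner ℝ (A u) w = 2 * inner ℝ (A w) u := by
    rw [hA, mv_symm P hPsymm u w, real_inner_comm]; ring
  have hgoal : inner ℝ (A w) u + inner ℝ (A u) w ≤
      k * inner ℝ (A w) w + 4 * m * (ε + δ) := by
    rw [hsum]
    have hu2 : u = (f τ (x τ) - f τ (y τ)) - mvL B (s - r) := by
      rw [hu, map_sub, mvL_apply, mvL_apply]; abel
    rw [hu2, inner_sub_right, hA, mv_adj B C P hPsymm hPB, ← hA]
    have h1 : inner ℝ (A w) (f τ (x τ) - f τ (y τ)) ≤ ‖A‖ * L * ‖w‖ ^ 2 := by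
      refine (real_inner_le_norm _ _).trans ?_
      have h2 := hfL τ ⟨hτ.1.le, hτ.2.le⟩ (x τ) (y τ)
      calc _ ≤ (‖A‖ * ‖w‖) * (L * ‖w‖) := by
            gcongr
            exact A.le_opNorm _
        _ = _ := by ring
    have h3 : ‖A‖ * L * ‖w‖ ^ 2 ≤ k / 2 * inner ℝ (A w) w := by
      calc _ = k / 2 * (c * ‖w‖ ^ 2) := by rw [hk]; field_simp
        _ ≤ _ := mul_le_mul_of_nonneg_left (hco w) (by positivity)
    have h4 : -(2 * m * (ε + δ)) ≤ ∑ i, (mvL C w) i * (s - r) i := by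
      have : ∑ i : Fin m, -(2 * (ε + δ)) = -(2 * m * (ε + δ)) := by
        simp; ring
      rw [← this]
      refine Finset.sum_le_sum fun i _ => ?_
      have := sgn_approx hε hδ (hs i) (hr i)
      have h5 : (mvL C w) i = (mv C (x τ) + D) i - (mv C (y τ) + D) i := by
        rw [hwdef, map_sub, mvL_apply, mvL_apply]; simp
      rw [h5]
      exact this
    linarith
  exact hgoal

lemma norm_le_of_coord {n : ℕ} {u v : EuclideanSpace ℝ (Fin n)} {K : ℝ} (hK : 0 ≤ K)
    (h : ∀ i, |u i| ≤ K * |v i|) : ‖u‖ ≤ K * ‖v‖ := by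
  apply le_of_sq_le_sq _ (by positivity)
  rw [mul_pow, EuclideanSpace.real_norm_sq_eq, EuclideanSpace.real_norm_sq_eq, Finset.mul_sum]
  refine Finset.sum_le_sum fun i _ => ?_
  rw [← sq_abs (u i), ← sq_abs (v i), ← mul_pow]
  exact pow_le_pow_left₀ (abs_nonneg _) (h i) 2

lemma norm_le_of_coord_bd {n : ℕ} {u : EuclideanSpace ℝ (Fin n)} {R : ℝ} (hR : 0 ≤ R)
    (h : ∀ i, |u i| ≤ R) : ‖u‖ ≤ R * Real.sqrt n := by
  apply le_of_sq_le_sq _ (by positivity)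
  rw [mul_pow, EuclideanSpace.real_norm_sq_eq, Real.sq_sqrt (by positivity)]
  calc ∑ i, u i ^ 2 ≤ ∑ i : Fin n, R ^ 2 := by
        refine Finset.sum_le_sum fun i _ => ?_
        rw [← sq_abs (u i)]
        exact pow_le_pow_left₀ (abs_nonneg _) (h i) 2
    _ = _ := by simp; ring

lemma sat_bd (a : ℝ) : |sat a| ≤ 1 := by
  unfold sat
  rw [abs_le]
  exact ⟨le_max_left _ _, max_le (by norm_num) (min_le_left _ _)⟩

lemma sat_zero : sat 0 = 0 := by simp [sat]

lemma sat_self {a : ℝ} (h : |a| ≤ 1) : sat a = a := by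
  rw [abs_le] at h
  rw [sat, min_eq_right h.2, max_eq_right h.1]

/-- Coordinatewise saturation. -/
def satV {n : ℕ} (ε : ℝ) (y : EuclideanSpace ℝ (Fin n)) : EuclideanSpace ℝ (Fin n) :=
  WithLp.toLp 2 fun i => sat (y i / ε)

lemma satV_lip {n : ℕ} {ε : ℝ} (hε : 0 < ε) (y z : EuclideanSpace ℝ (Fin n)) :
    ‖satV ε y - satV ε z‖ ≤ ε⁻¹ * ‖y - z‖ := by
  refine norm_le_of_coord (by positivity) fun i => ?_
  refine (sat_lip (y i / ε) (z i / ε)).trans (le_of_eq ?_)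
  rw [← sub_div, abs_div, abs_of_pos hε, PiLp.sub_apply]
  ring

lemma satV_bd {n : ℕ} (ε : ℝ) (y : EuclideanSpace ℝ (Fin n)) : ‖satV ε y‖ ≤ Real.sqrt n := by
  have := norm_le_of_coord_bd (u := satV ε y) zero_le_one (fun i => sat_bd _)
  simpa using this

/-- Coordinatewise truncation at level `R`. -/
def clampV {n : ℕ} (R : ℝ) (y : EuclideanSpace ℝ (Fin n)) : EuclideanSpace ℝ (Fin n) :=
  R • satV R y

lemma clampV_lip {n : ℕ} {R : ℝ} (hR : 0 < R) (y z : EuclideanSpace ℝ (Fin n)) :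
    ‖clampV R y - clampV R z‖ ≤ ‖y - z‖ := by
  unfold clampV
  rw [← smul_sub, norm_smul, Real.norm_of_nonneg hR.le]
  calc _ ≤ R * (R⁻¹ * ‖y - z‖) := by gcongr; exact satV_lip hR y z
    _ = _ := by field_simp

lemma clampV_zero {n : ℕ} (R : ℝ) : clampV R (0 : EuclideanSpace ℝ (Fin n)) = 0 := by
  ext i; simp [clampV, satV, sat_zero]

lemma clampV_norm {n : ℕ} {R : ℝ} (hR : 0 < R) (y : EuclideanSpace ℝ (Fin n)) :
    ‖clampV R y‖ ≤ ‖y‖ := by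
  simpa [clampV_zero] using clampV_lip hR y 0

lemma clampV_bd {n : ℕ} {R : ℝ} (hR : 0 < R) (y : EuclideanSpace ℝ (Fin n)) :
    ‖clampV R y‖ ≤ R * Real.sqrt n := by
  unfold clampV
  rw [norm_smul, Real.norm_of_nonneg hR.le]
  gcongr
  exact satV_bd R y

lemma clampV_self {n : ℕ} {R : ℝ} (hR : 0 < R) {y : EuclideanSpace ℝ (Fin n)} (hy : ‖y‖ ≤ R) :
    clampV R y = y := by
  ext i
  have h1 : |y i| ≤ ‖y‖ := PiLp.norm_apply_le y i
  have h2 : |y i / R| ≤ 1 := by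
    rw [abs_div, abs_of_pos hR, div_le_one hR]; linarith
  simp only [clampV, satV, PiLp.smul_apply, smul_eq_mul, sat_self h2]
  field_simp

lemma exists_approx {n m : ℕ} {T : ℝ} (hT : 0 < T)
    (B : Matrix (Fin n) (Fin m) ℝ) (C : Matrix (Fin m) (Fin n) ℝ)
    (D : EuclideanSpace ℝ (Fin m))
    {f : ℝ → EuclideanSpace ℝ (Fin n) → EuclideanSpace ℝ (Fin n)}
    (hfII : AssumptionII T f) (hfc : ∀ x, Continuous fun t => f t x)
    (x₀ : EuclideanSpace ℝ (Fin n)) :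
    ∃ M : NNReal, ∀ ε > 0, ∃ x : ℝ → EuclideanSpace ℝ (Fin n),
      LipschitzOnWith M x (Icc 0 T) ∧ x 0 = x₀ ∧
      ∀ t ∈ Ioo 0 T, ∃ s : EuclideanSpace ℝ (Fin m),
      (∀ i, s i ∈ sgnSet ((mv C (x t) + D) i - ε * s i)) ∧
      HasDerivAt x (f t (x t) - mv B s) t := by
  obtain ⟨L, hL, hfL⟩ := hfII
  obtain ⟨M0, hM0⟩ := (isCompact_Icc (a := (0:ℝ)) (b := T)).exists_bound_of_continuousOn
    (hfc 0).continuousOn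
  have hM0' : 0 ≤ M0 := (norm_nonneg _).trans (hM0 0 ⟨le_rfl, hT.le⟩)
  have hgrow : ∀ t ∈ Icc 0 T, ∀ z, ‖f t z‖ ≤ M0 + L * ‖z‖ := by
    intro t ht z
    have h1 := hfL t ht z 0
    rw [sub_zero] at h1
    have h2 := norm_sub_norm_le (f t z) (f t 0)
    have := hM0 t ht
    linarith
  set b := ‖mvL B‖ * Real.sqrt m with hb
  have hb0 : 0 ≤ b := by positivity
  have hBb : ∀ ε (y : EuclideanSpace ℝ (Fin m)), ‖mv B (satV ε y)‖ ≤ b := by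
    intro ε y
    rw [← mvL_apply]
    exact ((mvL B).le_opNorm _).trans (by rw [hb]; gcongr; exact satV_bd _ _)
  set G := gronwallBound ‖x₀‖ L (M0 + b) T with hG
  have hG0 : 0 ≤ G := by
    have := gronwallBound_mono (norm_nonneg x₀) (add_nonneg hM0' hb0) hL hT.le
    rw [gronwallBound_x0] at this
    exact (norm_nonneg _).trans this
  set R := G + 1 with hR
  have hR0 : 0 < R := by positivity
  set M := M0 + L * (R * Real.sqrt n) + b with hM
  have hMn : 0 ≤ M := by positivity
  refine ⟨M.toNNReal, fun ε hε => ?_⟩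
  set g : ℝ → EuclideanSpace ℝ (Fin n) → EuclideanSpace ℝ (Fin n) :=
    fun t x => f t (clampV R x) - mv B (satV ε (mv C x + D)) with hg
  have hgM : ∀ t ∈ Icc 0 T, ∀ x, ‖g t x‖ ≤ M := by
    intro t ht x
    refine (norm_sub_le _ _).trans ?_
    have h1 := hgrow t ht (clampV R x)
    have h2 : L * ‖clampV R x‖ ≤ L * (R * Real.sqrt n) := by gcongr; exact clampV_bd hR0 x
    linarith [hBb ε (mv C x + D)]
  have hgG : ∀ t ∈ Icc 0 T, ∀ x, ‖g t x‖ ≤ L * ‖x‖ + (M0 + b) := by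
    intro t ht x
    refine (norm_sub_le _ _).trans ?_
    have h1 := hgrow t ht (clampV R x)
    have h2 : L * ‖clampV R x‖ ≤ L * ‖x‖ := by gcongr; exact clampV_norm hR0 x
    linarith [hBb ε (mv C x + D)]
  have hpl : IsPicardLindelof g (tmin := 0) (tmax := T) ⟨0, le_rfl, hT.le⟩ x₀
      (M * T).toNNReal 0 M.toNNReal (L + ‖mvL B‖ * (ε⁻¹ * ‖mvL C‖)).toNNReal := by
    refine ⟨fun t ht => ?_, fun x _ => ?_, fun t ht x _ => ?_, ?_⟩
    · refine LipschitzOnWith.of_dist_le_mul fun x _ y _ => ?_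
      rw [Real.coe_toNNReal _ (by positivity), dist_eq_norm, dist_eq_norm]
      have h0 : g t x - g t y = (f t (clampV R x) - f t (clampV R y)) -
          mvL B (satV ε (mv C x + D) - satV ε (mv C y + D)) := by
        rw [map_sub, mvL_apply, mvL_apply]; simp only [hg]; abel
      rw [h0]
      have h1 : ‖f t (clampV R x) - f t (clampV R y)‖ ≤ L * ‖x - y‖ :=
        (hfL t ht _ _).trans (by gcongr; exact clampV_lip hR0 x y)
      have h3 : ‖satV ε (mv C x + D) - satV ε (mv C y + D)‖ ≤ ε⁻¹ * (‖mvL C‖ * ‖x - y‖) := by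
        refine (satV_lip hε _ _).trans ?_
        gcongr
        rw [add_sub_add_right_eq_sub, ← mvL_apply, ← mvL_apply, ← map_sub]
        exact (mvL C).le_opNorm _
      have h2 : ‖mvL B (satV ε (mv C x + D) - satV ε (mv C y + D))‖ ≤
          ‖mvL B‖ * (ε⁻¹ * (‖mvL C‖ * ‖x - y‖)) :=
        ((mvL B).le_opNorm _).trans (by gcongr)
      refine (norm_sub_le _ _).trans ((add_le_add h1 h2).trans (le_of_eq ?_))
      ring
    · exact ((hfc _).sub continuous_const).continuousOn
    · rw [Real.coe_toNNReal _ hMn]; exact hgM t ht x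
    · rw [Real.coe_toNNReal _ hMn, Real.coe_toNNReal _ (by positivity)]
      simp [hT.le]
  obtain ⟨x, hx0, hxd⟩ := hpl.exists_eq_forall_mem_Icc_hasDerivWithinAt₀
  simp only at hx0
  have hcont : ContinuousOn x (Icc 0 T) := HasDerivWithinAt.continuousOn hxd
  have hxb : ∀ t ∈ Icc 0 T, ‖x t‖ ≤ R := by
    intro t ht
    have := norm_le_gronwallBound_of_norm_deriv_right_le (f := x) (f' := fun t => g t (x t))
      (δ := ‖x₀‖) (K := L) (ε := M0 + b) (a := 0) (b := T) hcont
      (fun τ hτ => (hxd τ ⟨hτ.1, hτ.2.le⟩).mono_of_mem_nhdsWithin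
        (mem_of_superset (Icc_mem_nhdsGE hτ.2) (Icc_subset_Icc hτ.1 le_rfl)))
      (by rw [hx0]) (fun τ hτ => hgG τ ⟨hτ.1, hτ.2.le⟩ _) t ht
    have h2 := gronwallBound_mono (norm_nonneg x₀) (add_nonneg hM0' hb0) hL
      (show t - 0 ≤ T by linarith [ht.2])
    linarith
  refine ⟨x, ?_, hx0, fun t ht => ⟨satV ε (mv C (x t) + D), fun i => sat_mem hε, ?_⟩⟩
  · refine (convex_Icc 0 T).lipschitzOnWith_of_nnnorm_hasDerivWithin_le hxd fun t ht => ?_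
    rw [← NNReal.coe_le_coe, coe_nnnorm, Real.coe_toNNReal _ hMn]
    exact hgM t ht _
  · have h1 := (hxd t ⟨ht.1.le, ht.2.le⟩).hasDerivAt (Icc_mem_nhds ht.1 ht.2)
    simp only [hg] at h1
    rwa [clampV_self hR0 (hxb t ⟨ht.1.le, ht.2.le⟩)] at h1

lemma sgnSet_closed (a : ℝ) : IsClosed (sgnSet a) := by
  unfold sgnSet; split_ifs
  · exact isClosed_singleton
  · exact isClosed_singleton
  · exact isClosed_Icc

lemma sgnSet_convex (a : ℝ) : Convex ℝ (sgnSet a) := by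
  unfold sgnSet; split_ifs
  · exact convex_singleton _
  · exact convex_singleton _
  · exact convex_Icc _ _

lemma SgnSet_convex {m : ℕ} (y : EuclideanSpace ℝ (Fin m)) : Convex ℝ (SgnSet y) := by
  intro s hs r hr a b ha hb hab i
  exact sgnSet_convex _ (hs i) (hr i) ha hb hab

lemma SgnSet_compact {m : ℕ} (y : EuclideanSpace ℝ (Fin m)) : IsCompact (SgnSet y) := by
  refine Metric.isCompact_of_isClosed_isBounded ?_ ?_
  · have : SgnSet y = ⋂ i, (fun s : EuclideanSpace ℝ (Fin m) => s i) ⁻¹' sgnSet (y i) := by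
      ext s; simp [SgnSet]
    rw [this]
    exact isClosed_iInter fun i => (sgnSet_closed _).preimage (by fun_prop)
  · rw [isBounded_iff_forall_norm_le]
    refine ⟨1 * Real.sqrt m, fun s hs => norm_le_of_coord_bd zero_le_one fun i => ?_⟩
    exact abs_le.2 (sgn_bd (hs i))

/-- Upper semicontinuity of the regularised sign. -/
lemma sgn_usc (a : ℝ) : ∃ ρ > 0, ∀ z ε s : ℝ, |z - a| < ρ → 0 ≤ ε → ε < ρ →
    s ∈ sgnSet (z - ε * s) → s ∈ sgnSet a := by
  rcases lt_trichotomy a 0 with h | h | h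
  · refine ⟨-a / 2, by linarith, fun z ε s hz hε hε2 hs => ?_⟩
    obtain ⟨h1, h2⟩ := sgn_bd hs
    rw [abs_lt] at hz
    have h3 : z - ε * s < 0 := by nlinarith
    rw [sgnSet, if_neg h3.not_gt, if_pos h3] at hs
    rwa [sgnSet, if_neg h.not_gt, if_pos h]
  · refine ⟨1, one_pos, fun z ε s _ _ _ hs => ?_⟩
    have := sgn_bd hs
    simpa [sgnSet, h] using this
  · refine ⟨a / 2, by linarith, fun z ε s hz hε hε2 hs => ?_⟩
    obtain ⟨h1, h2⟩ := sgn_bd hs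
    rw [abs_lt] at hz
    have h3 : 0 < z - ε * s := by nlinarith
    rw [sgnSet, if_pos h3] at hs
    rwa [sgnSet, if_pos h]

lemma Sgn_usc {m : ℕ} (a : EuclideanSpace ℝ (Fin m)) :
    ∃ ρ > 0, ∀ (z : EuclideanSpace ℝ (Fin m)) (ε : ℝ) (s : EuclideanSpace ℝ (Fin m)),
    ‖z - a‖ < ρ → 0 ≤ ε → ε < ρ → (∀ i, s i ∈ sgnSet (z i - ε * s i)) → s ∈ SgnSet a := by
  choose ρ hρ h using fun i => sgn_usc (a i)
  have : ∃ r > 0, ∀ i, r ≤ ρ i := by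
    by_cases hm : Nonempty (Fin m)
    · obtain ⟨j, hj⟩ := Finite.exists_min ρ
      exact ⟨ρ j, hρ j, hj⟩
    · exact ⟨1, one_pos, fun i => (hm ⟨i⟩).elim⟩
  obtain ⟨r, hr, hri⟩ := this
  refine ⟨r, hr, fun z ε s hz hε hε2 hs i => ?_⟩
  refine h i (z i) ε (s i) ?_ hε (hε2.trans_le (hri i)) (hs i)
  have : |(z - a) i| ≤ ‖z - a‖ := PiLp.norm_apply_le (z - a) i
  rw [PiLp.sub_apply] at this
  linarith [hri i]

/-- The derivative of a limit of regularised solutions lies in the right-hand side. -/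
lemma limit_deriv {n m : ℕ} {T : ℝ}
    {B : Matrix (Fin n) (Fin m) ℝ} {C : Matrix (Fin m) (Fin n) ℝ}
    {D : EuclideanSpace ℝ (Fin m)}
    {f : ℝ → EuclideanSpace ℝ (Fin n) → EuclideanSpace ℝ (Fin n)}
    (hfII : AssumptionII T f) (hfc : ∀ x, Continuous fun t => f t x)
    {M : NNReal} {e : ℕ → ℝ} (he : ∀ k, 0 < e k) (he0 : Tendsto e atTop (𝓝 0))
    {X : ℕ → ℝ → EuclideanSpace ℝ (Fin n)} (hXl : ∀ k, LipschitzOnWith M (X k) (Icc 0 T))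
    (hXd : ∀ k, ∀ t ∈ Ioo 0 T, ∃ s : EuclideanSpace ℝ (Fin m),
      (∀ i, s i ∈ sgnSet ((mv C (X k t) + D) i - e k * s i)) ∧
      HasDerivAt (X k) (f t (X k t) - mv B s) t)
    {x : ℝ → EuclideanSpace ℝ (Fin n)}
    (hlim : ∀ t ∈ Icc 0 T, Tendsto (fun k => X k t) atTop (𝓝 (x t)))
    {t : ℝ} (ht : t ∈ Ioo 0 T) {v : EuclideanSpace ℝ (Fin n)} (hv : HasDerivAt x v t) :
    ∃ s ∈ SgnSet (mv C (x t) + D), v = f t (x t) - mv B s := by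
  obtain ⟨L, hL, hfL⟩ := hfII
  set a := mv C (x t) + D with ha
  set G := (fun s => f t (x t) - mvL B s) '' SgnSet a with hG
  have hGcpt : IsCompact G := (SgnSet_compact a).image (by fun_prop)
  have hGconv : Convex ℝ G := by
    have : G = (fun z => f t (x t) + z) '' ((-(mvL B)) '' SgnSet a) := by
      rw [hG, image_image]; simp [sub_eq_add_neg]
    rw [this]
    exact ((SgnSet_convex a).linear_image (-(mvL B)).toLinearMap).translate _
  suffices hvG : v ∈ G by
    obtain ⟨s, hs, rfl⟩ := hvG
    exact ⟨s, hs, rfl⟩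
  obtain ⟨ρ, hρ, husc⟩ := Sgn_usc a
  rw [← hGcpt.isClosed.closure_eq, Metric.closure_eq_iInter_cthickening]
  refine mem_iInter₂.2 fun η hη => ?_
  have htI : t ∈ Icc 0 T := ⟨ht.1.le, ht.2.le⟩
  -- smallness of `X k τ - x t`
  set θ := min (ρ / (‖mvL C‖ + 1)) (η / (2 * (L + 1))) with hθ
  have hθ0 : 0 < θ := lt_min (by positivity) (by positivity)
  have hnear : ∀ᶠ τ in 𝓝 t, τ ∈ Ioo 0 T ∧ M * dist τ t < θ / 2 ∧
      dist (f τ (x t)) (f t (x t)) < η / 2 := by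
    refine Eventually.and (Ioo_mem_nhds ht.1 ht.2) (Eventually.and ?_ ?_)
    · have : Tendsto (fun τ => (M : ℝ) * dist τ t) (𝓝 t) (𝓝 (M * dist t t)) :=
        Continuous.tendsto (by fun_prop) t
      rw [dist_self, mul_zero] at this
      exact this.eventually_lt_const (by positivity)
    · exact (Metric.tendsto_nhds.1 ((hfc (x t)).tendsto t)) _ (by positivity)
  obtain ⟨r, hr, hball⟩ := Metric.eventually_nhds_iff_ball.1 hnear
  have hk : ∀ᶠ k in atTop, e k < ρ ∧ dist (X k t) (x t) < θ / 2 :=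
    (he0.eventually_lt_const hρ).and (Metric.tendsto_nhds.1 (hlim t htI) _ (by positivity))
  have hder : ∀ᶠ k in atTop, ∀ τ ∈ Metric.ball t r,
      ∃ v ∈ Metric.cthickening η G, HasDerivAt (X k) v τ := by
    filter_upwards [hk] with k hk τ hτ
    obtain ⟨hτI, hτ1, hτ2⟩ := hball τ hτ
    obtain ⟨s, hs, hd⟩ := hXd k τ hτI
    refine ⟨_, ?_, hd⟩
    have hdist : ‖X k τ - x t‖ < θ := by
      rw [← dist_eq_norm]
      have h1 := (hXl k).dist_le_mul τ ⟨hτI.1.le, hτI.2.le⟩ t htI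
      have h2 := dist_triangle (X k τ) (X k t) (x t)
      linarith [hk.2]
    have hsa : s ∈ SgnSet a := by
      refine husc _ (e k) s ?_ (he k).le hk.1 hs
      rw [ha, add_sub_add_right_eq_sub, ← mvL_apply, ← mvL_apply, ← map_sub]
      have h1 := (mvL C).le_opNorm (X k τ - x t)
      have h2 : ‖X k τ - x t‖ < ρ / (‖mvL C‖ + 1) := hdist.trans_le (min_le_left _ _)
      rw [lt_div_iff₀ (by positivity)] at h2
      nlinarith [norm_nonneg (X k τ - x t)]
    refine Metric.mem_cthickening_of_dist_le _ (f t (x t) - mvL B s) η G ⟨s, hsa, rfl⟩ ?_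
    rw [mvL_apply, dist_sub_right]
    have h1 := hfL τ ⟨hτI.1.le, hτI.2.le⟩ (X k τ) (x t)
    rw [← dist_eq_norm] at h1
    have h2 : ‖X k τ - x t‖ < η / (2 * (L + 1)) := hdist.trans_le (min_le_right _ _)
    rw [lt_div_iff₀ (by positivity)] at h2
    have h3 := dist_triangle (f τ (X k τ)) (f τ (x t)) (f t (x t))
    nlinarith [norm_nonneg (X k τ - x t)]
  have hclosed : IsClosed (Metric.cthickening η G) := Metric.isClosed_cthickening
  have hconv : Convex ℝ (Metric.cthickening η G) := hGconv.cthickening η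
  have hslope : ∀ τ ∈ Ioo t (t + r), (τ - t)⁻¹ • (x τ - x t) ∈ Metric.cthickening η G := by
    intro τ hτ
    have hsub : Icc t τ ⊆ Metric.ball t r := by
      intro u hu
      rw [Metric.mem_ball, Real.dist_eq, abs_lt]
      constructor <;> linarith [hu.1, hu.2, hτ.2]
    have hτI := (hball τ (hsub ⟨hτ.1.le, le_rfl⟩)).1
    refine hclosed.mem_of_tendsto (((hlim τ ⟨hτI.1.le, hτI.2.le⟩).sub (hlim t htI)).const_smul
      (τ - t)⁻¹) ?_
    filter_upwards [hder] with k hk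
    refine slope_mem hclosed hconv hτ.1 ((hXl k).continuousOn.mono ?_) fun u hu =>
      hk u (hsub ⟨hu.1.le, hu.2.le⟩)
    exact Icc_subset_Icc ht.1.le hτI.2.le
  have hv' : HasDerivWithinAt x v (Ioi t) t := hv.hasDerivWithinAt
  rw [hasDerivWithinAt_iff_tendsto_slope' (by simp)] at hv'
  refine hclosed.mem_of_tendsto hv' ?_
  filter_upwards [Ioo_mem_nhdsGT (show t < t + r by linarith)] with τ hτ
  exact hslope τ hτ

/-- Well-posedness of the sliding-mode differential inclusion
`ẋ(t) ∈ f(t, x(t)) - B·Sgn(Cx(t) + D)`: if there is a symmetric positive definite `P` with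
`P·B_{•i} = (C_{i•})ᵀ` for all `i`, then for every initial condition there is a unique
Lipschitz solution on `[0,T]`. -/
theorem slidingMode_inclusion_existsUnique_lipschitzSolution
    (n m : ℕ) (T : ℝ) (hT : 0 < T)
    (B : Matrix (Fin n) (Fin m) ℝ) (C : Matrix (Fin m) (Fin n) ℝ)
    (D : EuclideanSpace ℝ (Fin m))
    (f : ℝ → EuclideanSpace ℝ (Fin n) → EuclideanSpace ℝ (Fin n))
    (hfII : AssumptionII T f) (hfIII : AssumptionIII T f)
    (P : Matrix (Fin n) (Fin n) ℝ) (hPsymm : P.IsSymm) (hPpos : P.PosDef)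
    (hPB : ∀ i : Fin m, P.mulVec (fun j => B j i) = fun j => C i j)
    (x₀ : EuclideanSpace ℝ (Fin n)) :
    ∃ x : ℝ → EuclideanSpace ℝ (Fin n),
      IsLipschitzSolution
        (fun t ξ => {v | ∃ s ∈ SgnSet (mv C ξ + D), v = f t ξ - mv B s}) T x₀ x ∧
      ∀ y : ℝ → EuclideanSpace ℝ (Fin n),
        IsLipschitzSolution
          (fun t ξ => {v | ∃ s ∈ SgnSet (mv C ξ + D), v = f t ξ - mv B s}) T x₀ y →
        ∀ t ∈ Icc (0 : ℝ) T, y t = x t := by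
  have hfc : ∀ x, Continuous fun t => f t x := fun x => (hfIII.1 x).continuous
  obtain ⟨Q, hQ, hcmp⟩ := apx_estimate (D := D) hT hfII hPsymm hPpos hPB x₀
  have hequiv : ∀ y, IsLipschitzSolution
      (fun t ξ => {v | ∃ s ∈ SgnSet (mv C ξ + D), v = f t ξ - mv B s}) T x₀ y →
      IsApx f B C D T x₀ 0 y := by
    rintro y ⟨h1, h2, h3⟩
    refine ⟨h1, h2, ?_⟩
    filter_upwards [h3] with t h4 ht
    obtain ⟨v, ⟨s, hs, rfl⟩, hd⟩ := h4 ht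
    exact ⟨s, fun i => by simpa using hs i, hd⟩
  suffices hex : ∃ x, IsLipschitzSolution
      (fun t ξ => {v | ∃ s ∈ SgnSet (mv C ξ + D), v = f t ξ - mv B s}) T x₀ x by
    obtain ⟨x, hx⟩ := hex
    refine ⟨x, hx, fun y hy t ht => ?_⟩
    have := hcmp 0 0 y x le_rfl le_rfl (hequiv y hy) (hequiv x hx) t ht
    rw [add_zero, mul_zero] at this
    have h2 : ‖y t - x t‖ = 0 := by nlinarith [norm_nonneg (y t - x t)]
    exact sub_eq_zero.1 (norm_eq_zero.1 h2)
  obtain ⟨M, hM⟩ := exists_approx hT B C D hfII hfc x₀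
  set e : ℕ → ℝ := fun k => 1 / ((k : ℝ) + 1) with he
  have hepos : ∀ k, 0 < e k := fun k => by positivity
  have he0 : Tendsto e atTop (𝓝 0) := tendsto_one_div_add_atTop_nhds_zero_nat
  choose X hXl hX0 hXd using fun k => hM (e k) (hepos k)
  have hapx : ∀ k, IsApx f B C D T x₀ (e k) (X k) := fun k =>
    ⟨⟨M, hXl k⟩, hX0 k, Eventually.of_forall (hXd k)⟩
  have hconv : ∀ t : ℝ, ∃ z, t ∈ Icc 0 T → Tendsto (fun k => X k t) atTop (𝓝 z) := by
    intro t
    by_cases ht : t ∈ Icc 0 T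
    · have hcau : CauchySeq fun k => X k t := by
        refine cauchySeq_of_le_tendsto_0 (fun N => Real.sqrt (Q * (e N + e N))) ?_ ?_
        · intro k l N hk hl
          rw [dist_eq_norm]
          refine Real.le_sqrt_of_sq_le ?_
          refine (hcmp _ _ _ _ (hepos k).le (hepos l).le (hapx k) (hapx l) t ht).trans ?_
          have h1 : e k ≤ e N := one_div_le_one_div_of_le (by positivity) (by gcongr)
          have h2 : e l ≤ e N := one_div_le_one_div_of_le (by positivity) (by gcongr)
          gcongr
        · have := ((he0.add he0).const_mul Q).sqrt
          simpa using this
      obtain ⟨z, hz⟩ := cauchySeq_tendsto_of_complete hcau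
      exact ⟨z, fun _ => hz⟩
    · exact ⟨0, fun h => (ht h).elim⟩
  choose x hx using hconv
  have hxl : LipschitzOnWith M x (Icc 0 T) := by
    refine LipschitzOnWith.of_dist_le_mul fun s hs t ht => ?_
    exact le_of_tendsto ((hx s hs).dist (hx t ht))
      (Eventually.of_forall fun k => (hXl k).dist_le_mul s hs t ht)
  refine ⟨x, ⟨M, hxl⟩, ?_, ?_⟩
  · refine tendsto_nhds_unique (hx 0 ⟨le_rfl, hT.le⟩) ?_
    simp only [hX0]
    exact tendsto_const_nhds
  · filter_upwards [hxl.ae_differentiableWithinAt_of_mem_real] with t hdt ht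
    have hd := ((hdt ⟨ht.1.le, ht.2.le⟩).differentiableAt (Icc_mem_nhds ht.1 ht.2)).hasDerivAt
    exact ⟨_, limit_deriv hfII hfc hepos he0 hXl hXd (fun t ht => hx t ht) ht hd, hd⟩
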